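/- arXiv:1609.09052 — 2 statements merged into one kernel-verified Lean document; each statement's English description precedes it below -/
import Mathlib

section
/- The Stieltjes transform m_d of the Kesten–McKay law with parameter d ≥ 3 is related to the semicircle Stieltjes transform by m_d(z) = 1/(-z - d(d-1)^{-1} m_sc(z)) = m_sc(z)/(1 - m_sc(z)²/(d-1)) for all z in the upper half-plane. -/
open MeasureTheory

/-- The Stieltjes transform of the semicircle law
`ρ_sc(x) = (1/2π) √(max (4 - x²) 0)`. -/
noncomputable def mscStieltjes (z : ℂ) : ℂ :=
  ∫ x : ℝ, ((Real.sqrt (max (4 - x ^ 2) 0) / (2 * Real.pi) : ℝ) : ℂ) / ((x : ℂ) - z)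

/-- The Stieltjes transform of the Kesten–McKay law with parameter `d`, whose density is
`ρ_d(x) = (1 + 1/(d-1) - x²/d)⁻¹ · (1/2π) √(max (4 - x²) 0)`. -/
noncomputable def mKMStieltjes (d : ℕ) (z : ℂ) : ℂ :=
  ∫ x : ℝ, (((1 + 1 / ((d : ℝ) - 1) - x ^ 2 / (d : ℝ))⁻¹ *
      (Real.sqrt (max (4 - x ^ 2) 0) / (2 * Real.pi)) : ℝ) : ℂ) / ((x : ℂ) - z)

/-- The density of the semicircle law. -/
noncomputable def semicircleDensity (x : ℝ) : ℝ :=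
  Real.sqrt (max (4 - x ^ 2) 0) / (2 * Real.pi)

lemma continuous_semicircleDensity : Continuous semicircleDensity := by
  unfold semicircleDensity
  fun_prop

lemma semicircleDensity_eq_zero {x : ℝ} (hx : x ∉ Set.Icc (-2 : ℝ) 2) :
    semicircleDensity x = 0 := by
  have h : 4 - x ^ 2 ≤ 0 := by
    by_contra! h
    exact hx ⟨by nlinarith, by nlinarith⟩
  simp [semicircleDensity, max_eq_right h]

lemma semicircleDensity_two_mul_cos {θ : ℝ} (hθ : 0 ≤ Real.sin θ) :
    semicircleDensity (2 * Real.cos θ) = Real.sin θ / Real.pi := by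
  have h : 4 - (2 * Real.cos θ) ^ 2 = (2 * Real.sin θ) ^ 2 := by
    nlinarith [Real.sin_sq_add_cos_sq θ]
  rw [semicircleDensity, h, max_eq_left (sq_nonneg _), Real.sqrt_sq (by positivity)]
  field_simp

lemma continuousOn_semicircleDensity_div {w : ℂ}
    (hw : ∀ x ∈ Set.Icc (-2 : ℝ) 2, (x : ℂ) ≠ w) :
    ContinuousOn (fun x : ℝ => (semicircleDensity x : ℂ) / ((x : ℂ) - w)) (Set.Icc (-2) 2) :=
  (Complex.continuous_ofReal.comp continuous_semicircleDensity).continuousOn.div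
    (by fun_prop) fun x hx => sub_ne_zero.2 (hw x hx)

lemma integrable_semicircleDensity_div {w : ℂ}
    (hw : ∀ x ∈ Set.Icc (-2 : ℝ) 2, (x : ℂ) ≠ w) :
    Integrable fun x : ℝ => (semicircleDensity x : ℂ) / ((x : ℂ) - w) :=
  ((continuousOn_semicircleDensity_div hw).integrableOn_Icc).integrable_of_forall_notMem_eq_zero
    fun x hx => by simp [semicircleDensity_eq_zero hx]

/-- The Joukowski-type map `m ↦ -(m + m⁻¹)` sends the punctured open unit disc off `[-2, 2]`. -/
lemma ofReal_ne_neg_add_inv {m : ℂ} (hm0 : m ≠ 0) (hm : ‖m‖ < 1) {x : ℝ}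
    (hx : x ∈ Set.Icc (-2 : ℝ) 2) : (x : ℂ) ≠ -(m + m⁻¹) := by
  intro h
  have hc : x = 2 * Real.cos (Real.arccos (x / 2)) := by
    rw [Real.cos_arccos (by linarith [hx.1]) (by linarith [hx.2])]
    ring
  set θ := Real.arccos (x / 2)
  have hprod : (m + Complex.exp (θ * Complex.I)) * (m + Complex.exp (-θ * Complex.I)) = 0 := by
    have he : Complex.exp (θ * Complex.I) * Complex.exp (-θ * Complex.I) = 1 := by
      rw [← Complex.exp_add]
      simp
    have hcos := Complex.two_cos (θ : ℂ)
    have hx' : (x : ℂ) = 2 * Complex.cos θ := by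
      rw [hc]
      push_cast
      rfl
    have hq : m ^ 2 + x * m + 1 = 0 := by
      rw [h]
      field_simp
      ring
    rw [hx', hcos] at hq
    linear_combination hq + he
  have key : ∀ t : ℝ, m + Complex.exp (t * Complex.I) ≠ 0 := by
    intro t ht
    have : ‖m‖ = 1 := by
      rw [eq_neg_of_add_eq_zero_left ht, norm_neg, Complex.norm_exp_ofReal_mul_I]
    linarith
  rcases mul_eq_zero.1 hprod with h1 | h1
  · exact key θ h1
  · exact key (-θ) (by simpa using h1)

lemma one_add_mul_ne_zero {m ζ : ℂ} (hm : ‖m‖ < 1) (hζ : ‖ζ‖ ≤ 1) : 1 + m * ζ ≠ 0 := by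
  intro h
  have h1 : ‖m * ζ‖ = 1 := by
    rw [eq_neg_of_add_eq_zero_right h, norm_neg, norm_one]
  rw [norm_mul] at h1
  nlinarith [norm_nonneg m, norm_nonneg ζ]

lemma integral_circleMap_zero_one {m : ℂ} (hm : ‖m‖ < 1) :
    ∫ θ in (0 : ℝ)..2 * Real.pi,
      m * (1 - circleMap 0 1 θ ^ 2) / (1 + m * circleMap 0 1 θ) = 2 * Real.pi * m := by
  have hd : DifferentiableOn ℂ (fun ζ : ℂ => m * (1 - ζ ^ 2) / (1 + m * ζ))
      (Metric.closedBall 0 1) := by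
    intro ζ hζ
    have := one_add_mul_ne_zero hm (mem_closedBall_zero_iff.1 hζ)
    exact ((by fun_prop : DifferentiableAt ℂ (fun ζ : ℂ => m * (1 - ζ ^ 2)) ζ).div
      (by fun_prop : DifferentiableAt ℂ (fun ζ : ℂ => 1 + m * ζ) ζ) this).differentiableWithinAt
  have h : DiffContOnCl ℂ (fun ζ : ℂ => m * (1 - ζ ^ 2) / (1 + m * ζ))
      (Metric.ball 0 |(1 : ℝ)|) := by
    apply DifferentiableOn.diffContOnCl
    rwa [abs_one, closure_ball _ one_ne_zero]
  have h2 := h.circleAverage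
  rw [Real.circleAverage_def] at h2
  rw [inv_smul_eq_iff₀ (by positivity)] at h2
  rw [h2]
  simp

lemma integral_semicircleDensity_div {m : ℂ} (hm0 : m ≠ 0) (hm : ‖m‖ < 1) :
    ∫ x : ℝ, (semicircleDensity x : ℂ) / ((x : ℂ) - -(m + m⁻¹)) = m := by
  have hw := fun x (hx : x ∈ Set.Icc (-2 : ℝ) 2) => ofReal_ne_neg_add_inv hm0 hm hx
  set g : ℝ → ℂ := fun x => (semicircleDensity x : ℂ) / ((x : ℂ) - -(m + m⁻¹)) with hg
  set F : ℝ → ℂ := fun θ => m * (1 - circleMap 0 1 θ ^ 2) / (1 + m * circleMap 0 1 θ) with hF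
  have hFc : Continuous F := by
    refine Continuous.div (by fun_prop) (by fun_prop) fun θ => ?_
    exact one_add_mul_ne_zero hm (by simp)
  have h1 : ∫ x, g x = ∫ x in (-2 : ℝ)..2, g x := by
    rw [intervalIntegral.integral_of_le (by norm_num), ← integral_Icc_eq_integral_Ioc]
    refine (setIntegral_eq_integral_of_forall_compl_eq_zero fun x hx => ?_).symm
    simp [hg, semicircleDensity_eq_zero hx]
  have h2 : ∫ θ in Real.pi..0, (-(2 * Real.sin θ)) • (g ∘ fun θ => 2 * Real.cos θ) θ =
      ∫ x in (-2 : ℝ)..2, g x := by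
    have := intervalIntegral.integral_deriv_smul_comp' (a := Real.pi) (b := 0)
      (f := fun θ => 2 * Real.cos θ) (f' := fun θ => -(2 * Real.sin θ)) (g := g)
      (fun θ _ => by simpa using (Real.hasDerivAt_cos θ).const_mul 2) (by fun_prop)
      ((continuousOn_semicircleDensity_div hw).mono ?_)
    · simpa using this
    · rintro _ ⟨θ, -, rfl⟩
      exact ⟨by linarith [Real.neg_one_le_cos θ], by linarith [Real.cos_le_one θ]⟩
  have h3 : ∫ θ in Real.pi..0, (-(2 * Real.sin θ)) • (g ∘ fun θ => 2 * Real.cos θ) θ =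
      (2 * Real.pi : ℂ)⁻¹ * ∫ θ in (0 : ℝ)..Real.pi, (F θ + F (2 * Real.pi - θ)) := by
    rw [intervalIntegral.integral_symm, ← intervalIntegral.integral_neg,
      ← intervalIntegral.integral_const_mul]
    refine intervalIntegral.integral_congr fun θ hθ => ?_
    rw [Set.uIcc_of_le Real.pi_pos.le] at hθ
    have hx : 2 * Real.cos θ ∈ Set.Icc (-2 : ℝ) 2 :=
      ⟨by linarith [Real.neg_one_le_cos θ], by linarith [Real.cos_le_one θ]⟩
    have hne := sub_ne_zero.2 (hw _ hx)
    have hd := semicircleDensity_two_mul_cos (Real.sin_nonneg_of_mem_Icc hθ)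
    have hinv : circleMap 0 1 (2 * Real.pi - θ) = (circleMap 0 1 θ)⁻¹ := by
      simp only [circleMap_zero, Complex.ofReal_one, one_mul, ← Complex.exp_neg]
      push_cast
      rw [sub_mul, Complex.exp_sub, Complex.exp_two_pi_mul_I, Complex.exp_neg, one_div]
    have hcos : (Real.cos θ : ℂ) = (circleMap 0 1 θ + (circleMap 0 1 θ)⁻¹) / 2 := by
      simp [circleMap_zero, Complex.cos, Complex.exp_neg]
    have hsin : (Real.sin θ : ℂ) ^ 2 = 1 - (Real.cos θ : ℂ) ^ 2 := by
      rw [← Complex.ofReal_pow, Real.sin_sq]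
      push_cast
      rfl
    have hz1 := one_add_mul_ne_zero hm (ζ := circleMap 0 1 θ) (by simp)
    have hz2 := one_add_mul_ne_zero hm (ζ := (circleMap 0 1 θ)⁻¹) (by simp)
    have hz0 : circleMap 0 1 θ ≠ 0 := by simp [circleMap_zero]
    have hpi : (Real.pi : ℂ) ≠ 0 := by exact_mod_cast Real.pi_ne_zero
    simp only [hg, hF, Function.comp, hd, hinv, Complex.real_smul] at hne ⊢
    push_cast only [Complex.ofReal_mul, Complex.ofReal_ofNat, Complex.ofReal_neg,
      Complex.ofReal_div] at hne ⊢
    have hfac : (2 * (Real.cos θ : ℂ) - -(m + m⁻¹)) =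
        (1 + m * circleMap 0 1 θ) * (1 + m * (circleMap 0 1 θ)⁻¹) / m := by
      rw [hcos]
      field_simp
      ring
    have hnum : 4 * (Real.sin θ : ℂ) ^ 2 =
        2 - circleMap 0 1 θ ^ 2 - (circleMap 0 1 θ)⁻¹ ^ 2 := by
      rw [hsin, hcos]
      field_simp
      ring
    rw [hfac]
    trans (2 * (Real.pi : ℂ))⁻¹ * (4 * (Real.sin θ : ℂ) ^ 2 * m /
      ((1 + m * circleMap 0 1 θ) * (1 + m * (circleMap 0 1 θ)⁻¹)))
    · field_simp
      ring
    · congr 1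
      rw [hnum, div_add_div _ _ hz1 hz2]
      congr 1
      field_simp
      ring
  have h4 : ∫ θ in (0 : ℝ)..Real.pi, (F θ + F (2 * Real.pi - θ)) = 2 * Real.pi * m := by
    rw [intervalIntegral.integral_add (hFc.intervalIntegrable _ _)
      (Continuous.intervalIntegrable (by fun_prop) _ _),
      intervalIntegral.integral_comp_sub_left (fun θ => F θ)]
    rw [show 2 * Real.pi - Real.pi = Real.pi by ring, sub_zero,
      intervalIntegral.integral_add_adjacent_intervals (hFc.intervalIntegrable _ _)
      (hFc.intervalIntegrable _ _)]
    exact integral_circleMap_zero_one hm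
  have hpi : (Real.pi : ℂ) ≠ 0 := by exact_mod_cast Real.pi_ne_zero
  rw [h1, ← h2, h3, h4]
  field_simp

/-- Every point of the upper half-plane is `-(m + m⁻¹)` for some `m` in the unit disc. -/
lemma exists_eq_neg_add_inv {z : ℂ} (hz : 0 < z.im) :
    ∃ m : ℂ, m ≠ 0 ∧ ‖m‖ < 1 ∧ z = -(m + m⁻¹) := by
  obtain ⟨s, hs⟩ := IsAlgClosed.exists_pow_nat_eq (z ^ 2 - 4) (n := 2) (by norm_num)
  set m := (-z + s) / 2 with hm
  have hq : m ^ 2 + z * m + 1 = 0 := by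
    rw [hm]
    linear_combination hs / 4
  have hm0 : m ≠ 0 := by
    intro h
    simp [h] at hq
  have hzm : z = -(m + m⁻¹) := by
    field_simp
    linear_combination hq
  rcases lt_trichotomy ‖m‖ 1 with h | h | h
  · exact ⟨m, hm0, h, hzm⟩
  · exfalso
    rw [hzm, Complex.inv_eq_conj h] at hz
    simp at hz
  · refine ⟨m⁻¹, inv_ne_zero hm0, ?_, by rw [inv_inv, add_comm]; exact hzm⟩
    rw [norm_inv]
    exact inv_lt_one_of_one_lt₀ h

lemma mscStieltjes_neg_add_inv {m : ℂ} (hm0 : m ≠ 0) (hm : ‖m‖ < 1) :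
    mscStieltjes (-(m + m⁻¹)) = m :=
  integral_semicircleDensity_div hm0 hm

lemma kestenMcKay_partial_fractions {b x : ℝ} {z : ℂ} (hb : 0 < b)
    (hxa : (x : ℂ) - (b + (b : ℂ)⁻¹) ≠ 0) (hxa' : (x : ℂ) - -(b + (b : ℂ)⁻¹) ≠ 0)
    (hxz : (x : ℂ) - z ≠ 0) (hza : z - (b + (b : ℂ)⁻¹) ≠ 0) (hza' : z - -(b + (b : ℂ)⁻¹) ≠ 0)
    (ρ : ℂ) :
    (1 + 1 / (b : ℂ) ^ 2 - (x : ℂ) ^ 2 / ((b : ℂ) ^ 2 + 1))⁻¹ * ρ / (x - z) =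
      (b ^ 2 + 1) / ((b + (b : ℂ)⁻¹) ^ 2 - z ^ 2) * (ρ / (x - z)) +
      b / (2 * (z - (b + (b : ℂ)⁻¹))) * (ρ / (x - (b + (b : ℂ)⁻¹))) +
      -(b / (2 * (z - -(b + (b : ℂ)⁻¹)))) * (ρ / (x - -(b + (b : ℂ)⁻¹))) := by
  have hb0 : (b : ℂ) ≠ 0 := by exact_mod_cast hb.ne'
  have hb1 : (b : ℂ) ^ 2 + 1 ≠ 0 := by
    exact_mod_cast (by positivity : b ^ 2 + 1 ≠ 0)
  set a : ℂ := b + (b : ℂ)⁻¹ with ha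
  have hab : (b : ℂ) ^ 2 + 1 = a * b := by
    rw [ha]
    field_simp
  have ha0 : a ≠ 0 := by
    intro h
    simp [hab, h] at hb1
  have hD : (1 + 1 / (b : ℂ) ^ 2 - (x : ℂ) ^ 2 / ((b : ℂ) ^ 2 + 1)) =
      -((x - a) * (x - -a)) / (a * b) := by
    rw [hab]
    have : 1 + 1 / (b : ℂ) ^ 2 = a / b := by
      rw [ha]
      field_simp
    rw [this]
    field_simp
    ring
  have hz2 : a ^ 2 - z ^ 2 = -((z - a) * (z - -a)) := by ring
  rw [hD, hz2, hab]
  generalize hp : (x : ℂ) - a = p at *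
  generalize hq : (x : ℂ) - -a = q at *
  generalize hr : (x : ℂ) - z = r at *
  generalize hs : z - a = s at *
  generalize ht : z - -a = t at *
  have h1 : q = p + 2 * a := by rw [← hp, ← hq]; ring
  have h2 : s = p - r := by rw [← hp, ← hr, ← hs]; ring
  have h3 : t = p - r + 2 * a := by rw [← hp, ← hr, ← ht]; ring
  field_simp
  subst h1 h2 h3
  ring

lemma mKMStieltjes_neg_add_inv {d : ℕ} (hd : 3 ≤ d) {m : ℂ} (hm0 : m ≠ 0) (hm : ‖m‖ < 1)
    (hz : 0 < (-(m + m⁻¹)).im) :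
    mKMStieltjes d (-(m + m⁻¹)) = m / (1 - m ^ 2 / ((d : ℂ) - 1)) := by
  set b : ℝ := Real.sqrt ((d : ℝ) - 1) with hbdef
  have hd' : (3 : ℝ) ≤ d := by exact_mod_cast hd
  have hb2 : b ^ 2 = (d : ℝ) - 1 := Real.sq_sqrt (by linarith)
  have hb1 : 1 < b := by
    rw [hbdef]
    exact Real.lt_sqrt_of_sq_lt (by linarith)
  have hb : 0 < b := by linarith
  have hb0 : (b : ℂ) ≠ 0 := by exact_mod_cast hb.ne'
  have hdR : (d : ℝ) = b ^ 2 + 1 := by linarith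
  have hdC : (d : ℂ) = (b : ℂ) ^ 2 + 1 := by exact_mod_cast hdR
  set z : ℂ := -(m + m⁻¹) with hzdef
  have hnorm : ‖(b : ℂ)⁻¹‖ < 1 := by
    rw [norm_inv, Complex.norm_real, Real.norm_of_nonneg hb.le]
    exact inv_lt_one_of_one_lt₀ hb1
  have hnorm' : ‖-(b : ℂ)⁻¹‖ < 1 := by rwa [norm_neg]
  have hi0 : (b : ℂ)⁻¹ ≠ 0 := inv_ne_zero hb0
  have hi0' : -(b : ℂ)⁻¹ ≠ 0 := neg_ne_zero.2 hi0
  have e1 : -((b : ℂ)⁻¹ + ((b : ℂ)⁻¹)⁻¹) = -(b + (b : ℂ)⁻¹) := by rw [inv_inv, add_comm]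
  have e2 : -(-(b : ℂ)⁻¹ + (-(b : ℂ)⁻¹)⁻¹) = b + (b : ℂ)⁻¹ := by
    rw [inv_neg, inv_inv]
    ring
  have w1 := fun x hx => ofReal_ne_neg_add_inv hi0 hnorm (x := x) hx
  have w2 := fun x hx => ofReal_ne_neg_add_inv hi0' hnorm' (x := x) hx
  have w3 := fun x hx => ofReal_ne_neg_add_inv hm0 hm (x := x) hx
  have I1 := integral_semicircleDensity_div hi0 hnorm
  have I2 := integral_semicircleDensity_div hi0' hnorm'
  have I3 := integral_semicircleDensity_div hm0 hm
  rw [e1] at w1 I1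
  rw [e2] at w2 I2
  rw [← hzdef] at w3 I3
  have hzr : ∀ r : ℝ, z - (r : ℂ) ≠ 0 := by
    intro r h
    rw [sub_eq_zero.1 h] at hz
    simp at hz
  have hza : z - (b + (b : ℂ)⁻¹) ≠ 0 := by exact_mod_cast hzr (b + b⁻¹)
  have hza' : z - -(b + (b : ℂ)⁻¹) ≠ 0 := by exact_mod_cast hzr (-(b + b⁻¹))
  have hint : mKMStieltjes d z = ∫ x : ℝ,
      ((b ^ 2 + 1) / ((b + (b : ℂ)⁻¹) ^ 2 - z ^ 2) * ((semicircleDensity x : ℂ) / (x - z)) +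
      b / (2 * (z - (b + (b : ℂ)⁻¹))) * ((semicircleDensity x : ℂ) / (x - (b + (b : ℂ)⁻¹))) +
      -(b / (2 * (z - -(b + (b : ℂ)⁻¹)))) *
        ((semicircleDensity x : ℂ) / (x - -(b + (b : ℂ)⁻¹)))) := by
    refine integral_congr_ae (Filter.Eventually.of_forall fun x => ?_)
    change (((1 + 1 / ((d : ℝ) - 1) - x ^ 2 / (d : ℝ))⁻¹ * semicircleDensity x : ℝ) : ℂ) /
      ((x : ℂ) - z) = _
    by_cases hx : x ∈ Set.Icc (-2 : ℝ) 2
    · beta_reduce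
      rw [← kestenMcKay_partial_fractions hb (sub_ne_zero.2 (w2 x hx)) (sub_ne_zero.2 (w1 x hx))
        (sub_ne_zero.2 (w3 x hx)) hza hza', hdR]
      push_cast
      rw [add_sub_cancel_right]
    · simp [semicircleDensity_eq_zero hx]
  have J1 := integrable_semicircleDensity_div w1
  have J2 := integrable_semicircleDensity_div w2
  have J3 := integrable_semicircleDensity_div w3
  rw [hint, integral_add (by exact (J3.const_mul _).add (J2.const_mul _)) (J1.const_mul _),
    integral_add (J3.const_mul _) (J2.const_mul _), integral_const_mul, integral_const_mul,
    integral_const_mul, I1, I2, I3, hdC, add_sub_cancel_right]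
  have f1 : z - (b + (b : ℂ)⁻¹) = -((b + m) * (1 + b * m)) / (b * m) := by
    rw [hzdef]
    field_simp
    ring
  have f2 : z - -(b + (b : ℂ)⁻¹) = (b - m) * (b * m - 1) / (b * m) := by
    rw [hzdef]
    field_simp
    ring
  have f3 : (b + (b : ℂ)⁻¹) ^ 2 - z ^ 2 =
      -((z - (b + (b : ℂ)⁻¹)) * (z - -(b + (b : ℂ)⁻¹))) := by ring
  rw [f1] at hza
  rw [f2] at hza'
  have g1 : (b : ℂ) + m ≠ 0 := by rintro h; simp [h] at hza
  have g2 : 1 + (b : ℂ) * m ≠ 0 := by rintro h; simp [h] at hza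
  have g3 : (b : ℂ) - m ≠ 0 := by rintro h; simp [h] at hza'
  have g4 : (b : ℂ) * m - 1 ≠ 0 := by rintro h; simp [h] at hza'
  have f4 : 1 - m ^ 2 / (b : ℂ) ^ 2 = (b - m) * (b + m) / b ^ 2 := by
    field_simp
    ring
  rw [f3, f1, f2, f4]
  field_simp
  ring

/-- For `d ≥ 3`, the Kesten–McKay Stieltjes transform is related to the semicircle
Stieltjes transform by `m_d(z) = 1/(-z - d (d-1)⁻¹ m_sc(z)) = m_sc(z)/(1 - m_sc(z)²/(d-1))`
for all `z` in the upper half-plane. -/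
theorem mKM_eq_msc (d : ℕ) (hd : 3 ≤ d) (z : ℂ) (hz : 0 < z.im) :
    mKMStieltjes d z = 1 / (-z - (d : ℂ) * ((d : ℂ) - 1)⁻¹ * mscStieltjes z) ∧
    mKMStieltjes d z = mscStieltjes z / (1 - (mscStieltjes z) ^ 2 / ((d : ℂ) - 1)) := by
  obtain ⟨m, hm0, hm, rfl⟩ := exists_eq_neg_add_inv hz
  rw [mscStieltjes_neg_add_inv hm0 hm, mKMStieltjes_neg_add_inv hd hm0 hm hz]
  refine ⟨?_, rfl⟩
  have hd1 : (d : ℂ) - 1 ≠ 0 := by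
    rw [sub_ne_zero]
    exact_mod_cast (by omega : d ≠ 1)
  have h : - -(m + m⁻¹) - (d : ℂ) * ((d : ℂ) - 1)⁻¹ * m = (1 - m ^ 2 / ((d : ℂ) - 1)) / m := by
    field_simp
    ring
  rw [h, one_div_div]
end

section
/- Let G be a (possibly infinite) graph in which every connected subgraph has excess at most ω. Then for any two vertices i, j and any k ≥ 1, the number of non-backtracking walks from i to j of length dist(i,j) + k − 1 is at most 2^{ωk}, provided ω ≥ 6. -/
open Finset in
theorem sum_two_pow_card_lt {α : Type*} [DecidableEq α] (s : Finset α) (t : α → ℕ) :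
    ∑ e ∈ s, 2 ^ #{e' ∈ s | t e' < t e} + 1 ≤ 2 ^ #s := by
  induction s using Finset.induction_on_max_value t with
  | empty => simp
  | insert a s ha hmax ih =>
    have h1 : ∀ e ∈ s, #{e' ∈ insert a s | t e' < t e} = #{e' ∈ s | t e' < t e} := by
      intro e he
      rw [filter_insert, if_neg (by have := hmax e he; omega)]
    have h2 : #{e' ∈ insert a s | t e' < t a} ≤ #s := by
      rw [filter_insert, if_neg (by omega)]
      exact card_filter_le _ _
    have h3 := Nat.pow_le_pow_right (show 0 < 2 by norm_num) h2
    rw [sum_insert ha, card_insert_of_notMem ha, sum_congr rfl fun e he => by rw [h1 e he], pow_succ]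
    omega

theorem encard_biUnion_le_sum {ι α : Type*} (s : Finset ι) (f : ι → Set α) (g : ι → ℕ)
    (h : ∀ i ∈ s, (f i).encard ≤ g i) : (⋃ i ∈ s, f i).encard ≤ (∑ i ∈ s, g i : ℕ) := by
  push_cast
  exact (s.set_encard_biUnion_le f).trans (Finset.sum_le_sum h)

open Finset in
theorem two_mul_card_le_of_swap_notMem {α : Type*} [DecidableEq α] {L E : Finset (α × α)}
    (hL : ∀ e ∈ L, e.swap ∈ L) (hE : E ⊆ L) (h : ∀ e ∈ E, e.swap ∉ E) : 2 * #E ≤ #L := by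
  have hd : Disjoint E (E.image Prod.swap) := by
    rw [disjoint_left]
    intro e he he'
    obtain ⟨e, he'', rfl⟩ := mem_image.1 he'
    exact h e he'' he
  have hsub : E ∪ E.image Prod.swap ⊆ L := union_subset hE fun e he => by
    obtain ⟨e', he', rfl⟩ := mem_image.1 he
    exact hL e' (hE he')
  have := card_le_card hsub
  rw [card_union_of_disjoint hd, card_image_of_injective _ Prod.swap_injective] at this
  omega

namespace SimpleGraph

variable {V : Type*}

/-- `p` sends every vertex `v ≠ j` in the component of `j` to a neighbour closer to `j`. -/
def IsParentMap (G : SimpleGraph V) (j : V) (p : V → V) : Prop :=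
  ∀ v, G.Reachable v j → v ≠ j → G.Adj v (p v) ∧ G.dist (p v) j + 1 = G.dist v j

/-- The step from `u` to `v` follows an edge of the tree defined by the parent map `p`. -/
def IsTreeStep (j : V) (p : V → V) (u v : V) : Prop :=
  (u ≠ j ∧ p u = v) ∨ (v ≠ j ∧ p v = u)

/-- The oriented edges in the component of `j` outside the tree of the parent map `p`. -/
def chords (G : SimpleGraph V) (j : V) (p : V → V) : Set (V × V) :=
  {e | G.Adj e.1 e.2 ∧ G.Reachable e.1 j ∧ ¬ IsTreeStep j p e.1 e.2}

variable {G : SimpleGraph V} {j : V} {p : V → V}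

theorem Adj.dist_le_dist_add_one {u v : V} (h : G.Adj u v) (hv : G.Reachable v j) :
    G.dist u j ≤ G.dist v j + 1 := by
  obtain ⟨q, hq⟩ := hv.exists_walk_length_eq_dist
  simpa [hq] using dist_le (q.cons h)

theorem exists_isParentMap (G : SimpleGraph V) (j : V) : ∃ p, IsParentMap G j p := by
  have : ∀ v, ∃ u, G.Reachable v j → v ≠ j → G.Adj v u ∧ G.dist u j + 1 = G.dist v j := by
    intro v
    by_cases hv : G.Reachable v j
    · obtain ⟨q, hq⟩ := hv.exists_walk_length_eq_dist
      cases q with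
      | nil => exact ⟨j, fun _ h => absurd rfl h⟩
      | cons h q =>
        refine ⟨_, fun _ _ => ⟨h, ?_⟩⟩
        have h1 := dist_le q
        have h2 := h.dist_le_dist_add_one q.reachable
        simp only [Walk.length_cons] at hq
        omega
    · exact ⟨v, fun h => absurd h hv⟩
  choose p hp using this
  exact ⟨p, hp⟩

theorem IsTreeStep.symm {u v : V} (h : IsTreeStep j p u v) : IsTreeStep j p v u := Or.symm h

theorem swap_mem_chords {e : V × V} (he : e ∈ chords G j p) : e.swap ∈ chords G j p :=
  ⟨he.1.symm, he.1.symm.reachable.trans he.2.1, fun h => he.2.2 h.symm⟩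

theorem IsParentMap.reachable (hp : IsParentMap G j p) {v : V} (hv : G.Reachable v j)
    (hvj : v ≠ j) : G.Reachable (p v) j :=
  (hp v hv hvj).1.symm.reachable.trans hv

theorem IsParentMap.exists_closed_of_reachable (hp : IsParentMap G j p) {v : V}
    (hv : G.Reachable v j) : ∃ S : Finset V, v ∈ S ∧ j ∈ S ∧ (∀ u ∈ S, G.Reachable u j) ∧
      ∀ u ∈ S, u ≠ j → p u ∈ S := by
  classical
  induction h : G.dist v j generalizing v with
  | zero =>
    obtain rfl := hv.dist_eq_zero_iff.1 h
    exact ⟨{v}, by simp⟩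
  | succ n ih =>
    have hvj : v ≠ j := by rintro rfl; simp at h
    obtain ⟨S, h1, h2, h3, h4⟩ := ih (hp.reachable hv hvj) (by have := (hp v hv hvj).2; omega)
    refine ⟨insert v S, by simp, by simp [h2], ?_, ?_⟩
    · simpa [hv] using h3
    · simp only [Finset.mem_insert, forall_eq_or_imp, h1, or_true, implies_true, true_and]
      exact fun u hu huj => Or.inr (h4 u hu huj)

theorem IsParentMap.exists_closed (hp : IsParentMap G j p) (T : Finset V)
    (hT : ∀ v ∈ T, G.Reachable v j) : ∃ S : Finset V, T ⊆ S ∧ j ∈ S ∧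
      (∀ u ∈ S, G.Reachable u j) ∧ ∀ u ∈ S, u ≠ j → p u ∈ S := by
  classical
  induction T using Finset.induction_on with
  | empty => exact ⟨{j}, by simp⟩
  | insert a T _ ih =>
    obtain ⟨S, h1, h2, h3, h4⟩ := ih fun v hv => hT v (by simp [hv])
    obtain ⟨S', h1', _, h3', h4'⟩ := hp.exists_closed_of_reachable (hT a (by simp))
    refine ⟨S ∪ S', ?_, by simp [h2], ?_, ?_⟩
    · intro v hv
      rcases Finset.mem_insert.1 hv with rfl | hv
      · simp [h1']
      · simp [h1 hv]
    · exact fun u hu => (Finset.mem_union.1 hu).elim (h3 u) (h3' u)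
    · exact fun u hu huj => (Finset.mem_union.1 hu).elim
        (fun h => Finset.mem_union_left _ (h4 u h huj))
        (fun h => Finset.mem_union_right _ (h4' u h huj))

theorem IsParentMap.connected_induce (hp : IsParentMap G j p) (S : Finset V) (hj : j ∈ S)
    (hS : ∀ u ∈ S, G.Reachable u j) (hcl : ∀ u ∈ S, u ≠ j → p u ∈ S) :
    (G.induce (S : Set V)).Connected := by
  have key : ∀ n, ∀ v (hv : v ∈ S), G.dist v j = n →
      (G.induce (S : Set V)).Reachable ⟨v, hv⟩ ⟨j, hj⟩ := by
    intro n
    induction n with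
    | zero =>
      intro v hv h
      obtain rfl := (hS v hv).dist_eq_zero_iff.1 h
      rfl
    | succ n ih =>
      intro v hv h
      have hvj : v ≠ j := by rintro rfl; simp at h
      obtain ⟨h1, h2⟩ := hp v (hS v hv) hvj
      have h3 : (G.induce (S : Set V)).Adj ⟨v, hv⟩ ⟨p v, hcl v hv hvj⟩ := h1
      exact h3.reachable.trans (ih _ _ (by omega))
  have : Nonempty (S : Set V) := ⟨⟨j, hj⟩⟩
  exact ⟨fun u v => (key _ u.1 u.2 rfl).trans (key _ v.1 v.2 rfl).symm⟩

open Finset in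
theorem IsParentMap.card_le_of_subset_chords (hp : IsParentMap G j p) {ω : ℕ}
    (hexc : ∀ S : Finset V,
      ((G.induce (↑S : Set V)).edgeSet.ncard : ℤ) - (S.card : ℤ)
        + (Nat.card ((G.induce (↑S : Set V)).ConnectedComponent) : ℤ) ≤ (ω : ℤ))
    (L : Finset (V × V)) (hL : (L : Set (V × V)) ⊆ chords G j p) : #L ≤ 2 * ω := by
  classical
  obtain ⟨S, hTS, hj, hS, hcl⟩ := hp.exists_closed (L.image Prod.fst ∪ L.image Prod.snd) (by
    intro v hv
    rcases mem_union.1 hv with hv | hv <;> obtain ⟨e, he, rfl⟩ := mem_image.1 hv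
    · exact (hL he).2.1
    · exact (swap_mem_chords (hL he)).2.1)
  have hconn := hp.connected_induce S hj hS hcl
  have hc : Nat.card (G.induce (S : Set V)).ConnectedComponent = 1 := by
    have := hconn.preconnected.subsingleton_connectedComponent
    have : Nonempty (G.induce (S : Set V)).ConnectedComponent :=
      ⟨(G.induce (S : Set V)).connectedComponentMk ⟨j, hj⟩⟩
    exact Nat.card_unique
  have hdart := (G.induce (S : Set V)).dart_card_eq_twice_card_edges
  have hE : (G.induce (S : Set V)).edgeSet.ncard = #(G.induce (S : Set V)).edgeFinset := by
    rw [← coe_edgeFinset, Set.ncard_coe_finset]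
  set f : V → V × V := fun v => (v, p v)
  set g : V → V × V := fun v => (p v, v)
  set D : (G.induce (S : Set V)).Dart → V × V := fun d => (d.fst.1, d.snd.1)
  have hadj : ∀ v ∈ S, v ≠ j → G.Adj v (p v) := fun v hv hvj => (hp v (hS v hv) hvj).1
  have hsub : ((S.erase j).image f ∪ (S.erase j).image g) ∪ L ⊆ univ.image D := by
    have key : ∀ u v (hu : u ∈ S) (hv : v ∈ S), G.Adj u v → (u, v) ∈ univ.image D :=
      fun u v hu hv h => mem_image.2 ⟨⟨(⟨u, hu⟩, ⟨v, hv⟩), h⟩, mem_univ _, rfl⟩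
    intro e he
    rcases mem_union.1 he with he | he
    · rcases mem_union.1 he with he | he <;> obtain ⟨v, hv, rfl⟩ := mem_image.1 he <;>
        obtain ⟨hvj, hv⟩ := mem_erase.1 hv
      · exact key _ _ hv (hcl v hv hvj) (hadj v hv hvj)
      · exact key _ _ (hcl v hv hvj) hv (hadj v hv hvj).symm
    · exact key _ _ (hTS (mem_union_left _ (mem_image_of_mem _ he)))
        (hTS (mem_union_right _ (mem_image_of_mem _ he))) (hL he).1
  have hd1 : Disjoint ((S.erase j).image f) ((S.erase j).image g) := by
    rw [Finset.disjoint_left]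
    intro e h1 h2
    obtain ⟨v, hv, rfl⟩ := mem_image.1 h1
    obtain ⟨u, hu, huv⟩ := mem_image.1 h2
    obtain ⟨hvj, hv⟩ := mem_erase.1 hv
    obtain ⟨huj, hu⟩ := mem_erase.1 hu
    simp only [f, g, Prod.mk.injEq] at huv
    have h3 := (hp v (hS v hv) hvj).2
    have h4 := (hp u (hS u hu) huj).2
    rw [← huv.2] at h3
    rw [huv.1] at h4
    omega
  have hd2 : Disjoint ((S.erase j).image f ∪ (S.erase j).image g) L := by
    rw [Finset.disjoint_left]
    intro e h1 h2
    apply (hL h2).2.2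
    rcases mem_union.1 h1 with he | he <;> obtain ⟨v, hv, rfl⟩ := mem_image.1 he
    · exact Or.inl ⟨(mem_erase.1 hv).1, rfl⟩
    · exact Or.inr ⟨(mem_erase.1 hv).1, rfl⟩
  have h1 := (card_le_card hsub).trans card_image_le
  rw [card_union_of_disjoint hd2, card_union_of_disjoint hd1,
    card_image_of_injective _ (fun a b h => (Prod.mk.inj h).1),
    card_image_of_injective _ (fun a b h => (Prod.mk.inj h).2), card_univ, hdart,
    card_erase_of_mem hj] at h1
  have h2 := hexc S
  rw [hc, hE] at h2
  have h3 : 0 < #S := card_pos.2 ⟨j, hj⟩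
  omega

theorem IsParentMap.finite_chords (hp : IsParentMap G j p) {ω : ℕ}
    (hexc : ∀ S : Finset V,
      ((G.induce (↑S : Set V)).edgeSet.ncard : ℤ) - (S.card : ℤ)
        + (Nat.card ((G.induce (↑S : Set V)).ConnectedComponent) : ℤ) ≤ (ω : ℤ)) :
    (chords G j p).Finite := by
  by_contra h
  obtain ⟨L, hL, hcard⟩ := Set.Infinite.exists_subset_card_eq h (2 * ω + 1)
  have := hp.card_le_of_subset_chords hexc L hL
  omega

/-- Non-backtracking walks of length `n` from `v` to `j`, continued by the constant `j`. -/
def nbWalks (G : SimpleGraph V) (j v : V) (n : ℕ) : Set (ℕ → V) :=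
  {w | w 0 = v ∧ (∀ m, n ≤ m → w m = j) ∧ (∀ m < n, G.Adj (w m) (w (m + 1))) ∧
    ∀ m, m + 2 ≤ n → w m ≠ w (m + 2)}

theorem reachable_of_mem_nbWalks {v : V} {n : ℕ} {w : ℕ → V} (hw : w ∈ nbWalks G j v n) (m : ℕ) :
    G.Reachable (w m) j := by
  by_cases h : n ≤ m
  · rw [hw.2.1 m h]
  · obtain ⟨d, hd⟩ := Nat.exists_eq_add_of_lt (not_le.1 h)
    induction d generalizing m with
    | zero =>
      have := (hw.2.2.1 m (by omega)).reachable
      rwa [hw.2.1 (m + 1) (by omega)] at this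
    | succ d ih =>
      exact (hw.2.2.1 m (by omega)).reachable.trans (ih (m + 1) (by omega) (by omega))

theorem shift_mem_nbWalks {v : V} {n : ℕ} {w : ℕ → V} (hw : w ∈ nbWalks G j v n) {s : ℕ}
    (hs : s ≤ n) : (fun m => w (m + s)) ∈ nbWalks G j (w s) (n - s) := by
  refine ⟨by simp, fun m hm => hw.2.1 _ (by omega), fun m hm => ?_, fun m hm => ?_⟩
  · have := hw.2.2.1 (m + s) (by omega)
    rwa [show m + s + 1 = m + 1 + s by omega] at this
  · have := hw.2.2.2 (m + s) (by omega)
    rwa [show m + s + 2 = m + 2 + s by omega] at this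

theorem dist_le_of_mem_nbWalks {v : V} {n : ℕ} {w : ℕ → V} (hw : w ∈ nbWalks G j v n) :
    G.dist v j ≤ n := by
  induction n generalizing v w with
  | zero => simp [← hw.1, hw.2.1 0 le_rfl]
  | succ n ih =>
    have h1 := ih (shift_mem_nbWalks hw (s := 1) (by omega))
    have h2 := (hw.2.2.1 0 (by omega)).dist_le_dist_add_one (reachable_of_mem_nbWalks hw 1)
    rw [hw.1] at h2
    simp only [zero_add] at h2
    omega

/-- A non-backtracking walk in the tree descends `a` steps and then ascends `b` steps. -/
theorem IsParentMap.exists_descent_ascent (hp : IsParentMap G j p) {w : ℕ → V} (s : ℕ)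
    (hr : ∀ m, G.Reachable (w m) j) (hstep : ∀ m < s, IsTreeStep j p (w m) (w (m + 1)))
    (hnb : ∀ m, m + 2 ≤ s → w m ≠ w (m + 2)) :
    ∃ a b, a + b = s ∧ (∀ m ≤ a, w m = p^[m] (w 0)) ∧ (∀ m ≤ b, w (s - m) = p^[m] (w s)) ∧
      G.dist (w a) j + a = G.dist (w 0) j ∧ G.dist (w a) j + b = G.dist (w s) j ∧
      (b ≠ 0 → w s ≠ j) := by
  induction s with
  | zero => exact ⟨0, 0, by simp⟩
  | succ s ih =>
    obtain ⟨a, b, hab, h1, h2, h3, h4, h5⟩ := ih (fun m hm => hstep m (by omega))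
      (fun m hm => hnb m (by omega))
    rcases hstep s (by omega) with ⟨hj, hd⟩ | ⟨hj, hu⟩
    · have hb : b = 0 := by
        by_contra hb
        have h6 := h2 1 (by omega)
        have h7 := hnb (s - 1) (by omega)
        rw [show s - 1 + 2 = s + 1 by omega, h6, ← hd] at h7
        exact h7 rfl
      subst hb
      obtain rfl : a = s := by omega
      have h8 := (hp _ (hr a) hj).2
      rw [hd] at h8
      refine ⟨a + 1, 0, rfl, fun m hm => ?_, by simp, by omega, by omega, by simp⟩
      rcases Nat.lt_or_ge a m with h | h
      · obtain rfl : m = a + 1 := by omega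
        rw [Function.iterate_succ_apply', ← h1 a le_rfl, hd]
      · exact h1 m h
    · have h8 := (hp _ (hr (s + 1)) hj).2
      rw [hu] at h8
      refine ⟨a, b + 1, by omega, h1, fun m hm => ?_, h3, by omega, fun _ => hj⟩
      cases m with
      | zero => rfl
      | succ m =>
        rw [Function.iterate_succ_apply, hu, ← h2 m (by omega)]
        congr 1
        omega

theorem descent_ascent_unique_aux {w w' : ℕ → V} {a b a' b' : ℕ}
    (hx : w (a + b) = w' (a' + b')) (hv : w 0 = w' 0)
    (h1 : ∀ m ≤ a, w m = p^[m] (w 0)) (h1' : ∀ m ≤ a', w' m = p^[m] (w' 0))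
    (h2 : ∀ m ≤ b, w (a + b - m) = p^[m] (w (a + b)))
    (h2' : ∀ m ≤ b', w' (a' + b' - m) = p^[m] (w' (a' + b')))
    (hnb' : ∀ m, m + 2 ≤ a' + b' → w' m ≠ w' (m + 2)) (hl : a + b' = a' + b) : a' ≤ a := by
  by_contra! h
  have e1 : w a = p^[a] (w 0) := h1 a le_rfl
  have e2 : w a = p^[b] (w (a + b)) := by rw [← h2 b le_rfl]; congr 1; omega
  have e3 : w' (a' - 1) = p^[a' - 1 - a] (w a) := by
    rw [h1' _ (by omega), e1, ← Function.iterate_add_apply, hv]; congr 2; omega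
  have e4 : w' (a' - 1 + 2) = p^[a' - 1 - a] (w a) := by
    rw [e2, ← Function.iterate_add_apply, hx, show a' - 1 - a + b = b' - 1 by omega,
      ← h2' _ (by omega)]
    congr 1
    omega
  exact hnb' (a' - 1) (by omega) (e3.trans e4.symm)

/-- Walks whose first step outside the tree is the chord `e`. -/
def nbWalksVia (G : SimpleGraph V) (j : V) (p : V → V) (v : V) (n : ℕ) (e : V × V) :
    Set (ℕ → V) :=
  {w | w ∈ nbWalks G j v n ∧ ∃ s < n, (∀ m < s, IsTreeStep j p (w m) (w (m + 1))) ∧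
    w s = e.1 ∧ w (s + 1) = e.2}

theorem IsParentMap.nbWalksVia_bound (hp : IsParentMap G j p) {v : V} {c : ℕ} {e : V × V}
    (hne : (nbWalksVia G j p v (G.dist v j + c) e).Nonempty) :
    ∃ a b c', (nbWalksVia G j p v (G.dist v j + c) e).encard ≤
        (nbWalks G j e.2 (G.dist e.2 j + c')).encard ∧
      G.dist e.2 j + c' < G.dist v j + c ∧ c' + 2 * b + 1 + G.dist e.2 j = c + G.dist e.1 j ∧
      G.dist e.1 j + a = G.dist v j + b ∧ (b = 0 → e.1 = p^[a] v) ∧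
      G.Reachable e.2 j := by
  obtain ⟨w, hw, s, hs, hstep, hx, hy⟩ := hne
  obtain ⟨a, b, rfl, h1, h2, h3, h4, -⟩ := hp.exists_descent_ascent s
    (reachable_of_mem_nbWalks hw) hstep (fun m hm => hw.2.2.2 m (by omega))
  have hlen := dist_le_of_mem_nbWalks (shift_mem_nbWalks hw (s := a + b + 1) (by omega))
  have hry := reachable_of_mem_nbWalks hw (a + b + 1)
  rw [hy] at hlen hry
  rw [hw.1] at h1 h3
  rw [hx] at h4 h2
  refine ⟨a, b, G.dist v j + c - (a + b + 1) - G.dist e.2 j, ?_, by omega, by omega, by omega,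
    ?_, hry⟩
  · rw [show G.dist e.2 j + (G.dist v j + c - (a + b + 1) - G.dist e.2 j)
      = G.dist v j + c - (a + b + 1) by omega]
    have uniq : ∀ w' ∈ nbWalksVia G j p v (G.dist v j + c) e,
        (∀ m ≤ a + b, w' m = w m) ∧ w' (a + b + 1) = e.2 := by
      rintro w' ⟨hw', s', hs', hstep', hx', hy'⟩
      obtain ⟨a', b', rfl, h1', h2', h3', h4', -⟩ := hp.exists_descent_ascent s'
        (reachable_of_mem_nbWalks hw') hstep' (fun m hm => hw'.2.2.2 m (by omega))
      rw [hw'.1] at h1' h3'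
      rw [hx'] at h4' h2'
      have l1 : a' ≤ a := descent_ascent_unique_aux (hx.trans hx'.symm) (hw.1.trans hw'.1.symm)
        (by rwa [hw.1]) (by rwa [hw'.1]) (by rwa [hx]) (by rwa [hx'])
        (fun m hm => hw'.2.2.2 m (by omega)) (by omega)
      have l2 : a ≤ a' := descent_ascent_unique_aux (hx'.trans hx.symm) (hw'.1.trans hw.1.symm)
        (by rwa [hw'.1]) (by rwa [hw.1]) (by rwa [hx']) (by rwa [hx])
        (fun m hm => hw.2.2.2 m (by omega)) (by omega)
      obtain rfl : a' = a := by omega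
      obtain rfl : b' = b := by omega
      refine ⟨fun m hm => ?_, hy'⟩
      rcases Nat.lt_or_ge a' m with h | h
      · have e1 := h2 (a' + b' - m) (by omega)
        rw [← h2' (a' + b' - m) (by omega), show a' + b' - (a' + b' - m) = m by omega] at e1
        exact e1.symm
      · rw [h1 m h, h1' m h]
    refine Set.encard_le_encard_of_injOn (f := fun w m => w (m + (a + b + 1))) ?_ ?_
    · intro w' hw'
      have := shift_mem_nbWalks hw'.1 (s := a + b + 1) (by omega)
      rwa [(uniq w' hw').2] at this
    · intro w₁ hw₁ w₂ hw₂ h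
      funext m
      rcases Nat.lt_or_ge (a + b) m with hm | hm
      · have := congrFun h (m - (a + b + 1))
        simpa [show m - (a + b + 1) + (a + b + 1) = m by omega] using this
      · rw [(uniq w₁ hw₁).1 m hm, (uniq w₂ hw₂).1 m hm]
  · rintro rfl
    rw [← h1 a le_rfl, ← hx]
    rfl

theorem IsParentMap.nbWalks_subset (hp : IsParentMap G j p) {v : V} {c : ℕ} :
    nbWalks G j v (G.dist v j + c) ⊆
      {w | c = 0 ∧ w = fun m => if m ≤ G.dist v j then p^[m] v else j} ∪
        ⋃ e ∈ chords G j p, nbWalksVia G j p v (G.dist v j + c) e := by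
  classical
  intro w hw
  by_cases h : ∀ m < G.dist v j + c, IsTreeStep j p (w m) (w (m + 1))
  · left
    obtain ⟨a, b, hab, h1, h2, h3, h4, h5⟩ := hp.exists_descent_ascent _
      (reachable_of_mem_nbWalks hw) h hw.2.2.2
    have hend := hw.2.1 _ (le_refl (G.dist v j + c))
    obtain rfl : b = 0 := by
      by_contra hb
      exact h5 hb hend
    rw [hw.1] at h1 h3
    have hc : c = 0 := by
      rw [hend] at h4
      simp only [dist_self] at h4
      omega
    refine ⟨hc, ?_⟩
    funext m
    split_ifs with hm
    · exact h1 m (by omega)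
    · exact hw.2.1 m (by omega)
  · right
    push Not at h
    let s := Nat.find h
    obtain ⟨hs, hst⟩ := Nat.find_spec h
    refine Set.mem_iUnion₂.2 ⟨(w s, w (s + 1)), ⟨hw.2.2.1 s hs,
      reachable_of_mem_nbWalks hw s, hst⟩, hw, s, hs, fun m hm => ?_, rfl, rfl⟩
    by_contra hm'
    exact Nat.find_min h hm ⟨hm.trans hs, hm'⟩

open Finset in
theorem encard_nbWalks_aux_arith {ω A m t c P T X Y : ℕ} (hω : 6 ≤ ω) (hA : A + m ≤ ω)
    (ht : t ≤ 2 * ω) (hT : T + 1 ≤ P)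
    (hX : X = if c = 0 then 0 else 2 ^ A * 2 ^ (ω * (c - 1)))
    (hY : Y = if c < 2 then 0 else 2 ^ A * 2 ^ (ω * (c - 2))) :
    (if c = 0 then 1 else 0) + (T * 2 ^ (ω * c) + (m * X + t * Y)) ≤ P * 2 ^ (ω * c) := by
  have h1 : 2 * (m * 2 ^ A) ≤ 2 ^ ω := by
    cases m with
    | zero => simp
    | succ m =>
      calc 2 * ((m + 1) * 2 ^ A) ≤ 2 * (2 ^ m * 2 ^ A) := by gcongr; exact Nat.lt_two_pow_self
        _ = 2 ^ (A + (m + 1)) := by ring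
        _ ≤ 2 ^ ω := Nat.pow_le_pow_right (by norm_num) hA
  have h2 : 4 * ω ≤ 2 ^ ω := by
    clear hA ht h1 hX hY
    induction ω, hω using Nat.le_induction with
    | base => norm_num
    | succ n hn ih => rw [pow_succ]; omega
  have h3 : 2 ^ A ≤ 2 ^ ω := Nat.pow_le_pow_right (by norm_num) (by omega)
  have h4 : (T + 1) * 2 ^ (ω * c) ≤ P * 2 ^ (ω * c) := Nat.mul_le_mul_right _ hT
  rcases c with _ | _ | c
  · simp only [if_true, Nat.zero_lt_two] at hX hY
    subst hX hY
    simp at h4 ⊢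
    omega
  · simp at hX hY
    subst hX hY
    simp only [zero_add, mul_one, one_ne_zero, if_false, mul_zero, add_zero] at h4 ⊢
    linarith
  · simp at hX hY
    subst hX hY
    have h5 : 2 ^ (ω * (c + 1)) = 2 ^ (ω * c) * 2 ^ ω := by ring
    have h6 : 2 ^ (ω * (c + 1 + 1)) = 2 ^ (ω * c) * (2 ^ ω * 2 ^ ω) := by ring
    have h7 : m * 2 ^ A * 2 ^ ω + t * 2 ^ A ≤ 2 ^ ω * 2 ^ ω := by
      have e1 := Nat.mul_le_mul_right (2 ^ ω) h1
      have e2 : t * 2 ^ A ≤ (2 * ω) * 2 ^ ω := Nat.mul_le_mul ht h3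
      have e3 := Nat.mul_le_mul_right (2 ^ ω) h2
      linarith
    have h8 := Nat.mul_le_mul_left (2 ^ (ω * c)) h7
    simp only [Nat.add_eq_zero_iff, one_ne_zero, and_false, if_false, h5]
    rw [h6] at h4 ⊢
    linarith

open Finset in
theorem IsParentMap.encard_nbWalks_le (hp : IsParentMap G j p) {ω : ℕ} (hω : 6 ≤ ω)
    [DecidableEq V] {L : Finset (V × V)} (hL : (L : Set (V × V)) = chords G j p)
    (hcard : #L ≤ 2 * ω) {D : Finset (V × V)}
    (hD : D = {e ∈ L | G.dist e.2 j + 1 = G.dist e.1 j}) (n : ℕ) {v : V}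
    (hv : G.Reachable v j) (c : ℕ) (hn : G.dist v j + c = n) :
    (nbWalks G j v n).encard ≤
      (2 ^ #{e ∈ D | G.dist e.1 j ≤ G.dist v j} * 2 ^ (ω * c) : ℕ) := by
  classical
  induction n using Nat.strong_induction_on generalizing v c with
  | _ n ih =>
  subst hn
  have hmem : ∀ {e}, e ∈ L ↔ e ∈ chords G j p := fun {e} => by rw [← hL]; rfl
  set H : Finset (V × V) := {e ∈ L | G.dist e.1 j = G.dist e.2 j} with hH
  set C₀ : Finset (V × V) := {e ∈ D | G.dist e.1 j ≤ G.dist v j} with hC₀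
  set C₁ : Finset (V × V) := {e ∈ H | ∃ a, G.dist e.1 j + a = G.dist v j ∧ e.1 = p^[a] v} with hC₁
  have hDH : #D + #C₁ ≤ ω := by
    have hDL : ∀ e ∈ D, G.dist e.2 j + 1 = G.dist e.1 j := fun e he =>
      by
      rw [hD] at he
      exact (mem_filter.1 he).2
    have hCH : ∀ e ∈ C₁, G.dist e.1 j = G.dist e.2 j := fun e he =>
      (mem_filter.1 (mem_filter.1 he).1).2
    have hd : Disjoint D C₁ := by
      rw [Finset.disjoint_left]
      intro e h1 h2
      have := hDL e h1
      have := hCH e h2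
      omega
    have hC₁L : C₁ ⊆ L := (filter_subset _ _).trans (filter_subset _ _)
    have := two_mul_card_le_of_swap_notMem (fun e he => hmem.2 (swap_mem_chords (hmem.1 he)))
      (union_subset (hD ▸ filter_subset _ _) hC₁L) (E := D ∪ C₁) (by
        intro e h1 h2
        rcases mem_union.1 h1 with h1 | h1 <;> rcases mem_union.1 h2 with h2 | h2
        · have h3 := hDL _ h1
          have h4 : G.dist e.1 j + 1 = G.dist e.2 j := hDL _ h2
          omega
        · have h3 := hDL _ h1
          have h4 : G.dist e.2 j = G.dist e.1 j := hCH _ h2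
          omega
        · have h3 := hCH _ h1
          have h4 : G.dist e.1 j + 1 = G.dist e.2 j := hDL _ h2
          omega
        · obtain ⟨-, a, h5, h6⟩ := mem_filter.1 h1
          obtain ⟨-, a', h5', h6'⟩ := mem_filter.1 h2
          have h7 := hCH _ h1
          simp only [Prod.fst_swap] at h5' h6'
          obtain rfl : a = a' := by omega
          exact (hmem.1 (hC₁L h1)).1.ne (h6.trans h6'.symm))
    rw [card_union_of_disjoint hd] at this
    omega
  set X : ℕ := if c = 0 then 0 else 2 ^ #D * 2 ^ (ω * (c - 1)) with hX
  set Y : ℕ := if c < 2 then 0 else 2 ^ #D * 2 ^ (ω * (c - 2)) with hY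
  set g : V × V → ℕ := fun e => if e ∈ C₀ then
      2 ^ #{e' ∈ C₀ | G.dist e'.1 j < G.dist e.1 j} * 2 ^ (ω * c)
    else if e ∈ C₁ then X else Y with hg
  have hbound : ∀ e ∈ L, (nbWalksVia G j p v (G.dist v j + c) e).encard ≤ g e := by
    intro e he
    rcases (nbWalksVia G j p v (G.dist v j + c) e).eq_empty_or_nonempty with h0 | h0
    · simp [h0]
    obtain ⟨a, b, c', h1, h2, h3, h4, h5, h6⟩ := hp.nbWalksVia_bound h0
    refine (h1.trans (ih _ h2 h6 c' rfl)).trans (Nat.cast_le.2 ?_)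
    have hle : #{e' ∈ D | G.dist e'.1 j ≤ G.dist e.2 j} ≤ #D := card_filter_le _ _
    have hadj := (hmem.1 he).1
    have l1 := hadj.dist_le_dist_add_one h6
    have l2 := hadj.symm.dist_le_dist_add_one (hmem.1 he).2.1
    simp only [hg]
    split_ifs with hc0 hc1
    · obtain ⟨h7, h8⟩ := mem_filter.1 hc0
      rw [hD] at h7
      have h7 := (mem_filter.1 h7).2
      refine Nat.mul_le_mul (Nat.pow_le_pow_right (by norm_num) (card_le_card ?_))
        (Nat.pow_le_pow_right (by norm_num) (Nat.mul_le_mul_left _ (by omega)))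
      intro e' he'
      obtain ⟨h9, h10⟩ := mem_filter.1 he'
      exact mem_filter.2 ⟨mem_filter.2 ⟨h9, by omega⟩, by omega⟩
    · have h7 := (mem_filter.1 (mem_filter.1 hc1).1).2
      rw [hX, if_neg (by omega)]
      exact Nat.mul_le_mul (Nat.pow_le_pow_right (by norm_num) hle)
        (Nat.pow_le_pow_right (by norm_num) (Nat.mul_le_mul_left _ (by omega)))
    · have hc2 : c' + 2 ≤ c := by
        by_contra hlt
        rcases Nat.lt_trichotomy (G.dist e.1 j) (G.dist e.2 j) with h | h | h
        · omega
        · exact hc1 (mem_filter.2 ⟨mem_filter.2 ⟨he, h⟩, a, by omega, h5 (by omega)⟩)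
        · exact hc0 (mem_filter.2 ⟨hD ▸ mem_filter.2 ⟨he, by omega⟩, by omega⟩)
      rw [hY, if_neg (by omega)]
      exact Nat.mul_le_mul (Nat.pow_le_pow_right (by norm_num) hle)
        (Nat.pow_le_pow_right (by norm_num) (Nat.mul_le_mul_left _ (by omega)))
  have hsum : ∑ e ∈ L, g e ≤ (∑ e ∈ C₀, 2 ^ #{e' ∈ C₀ | G.dist e'.1 j < G.dist e.1 j})
      * 2 ^ (ω * c) + (#C₁ * X + #L * Y) := by
    have hC₀L : C₀ ⊆ L := (filter_subset _ _).trans (hD ▸ filter_subset _ _)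
    simp only [hg]
    rw [sum_ite, sum_ite, sum_const, sum_const, smul_eq_mul, smul_eq_mul, ← sum_mul,
      filter_mem_eq_inter, inter_eq_right.2 hC₀L]
    gcongr
    · exact fun e he => (mem_filter.1 he).2
    · exact (filter_subset _ _).trans (filter_subset _ _)
  have hbase : {w | c = 0 ∧ w = fun m => if m ≤ G.dist v j then p^[m] v else j}.encard ≤
      ((if c = 0 then 1 else 0 : ℕ) : ℕ∞) := by
    split_ifs with h <;> simp [h]
  have hunion := encard_biUnion_le_sum L _ g hbound
  have harith := encard_nbWalks_aux_arith hω hDH hcard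
    (sum_two_pow_card_lt C₀ fun e => G.dist e.1 j) hX hY
  refine (Set.encard_le_encard hp.nbWalks_subset).trans ((Set.encard_union_le _ _).trans ?_)
  simp only [← hmem]
  refine (add_le_add hbase hunion).trans ?_
  rw [← Nat.cast_add]
  exact Nat.cast_le.2 (le_trans (Nat.add_le_add_left hsum _) harith)

end SimpleGraph


/-- Counting non-backtracking walks in a graph of bounded excess: if every finite
(induced) subgraph of `G` has excess at most `ω` (excess = #edges − #vertices +
#components), `ω ≥ 6`, then for any vertices `i, j` and any `k ≥ 1`, the number of
non-backtracking walks from `i` to `j` of length `dist(i,j) + k − 1` is at most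
`2^{ωk}`. A non-backtracking walk of length `n` is a sequence of `n+1` vertices with
consecutive vertices adjacent and no step immediately reversed. -/
theorem nbw_count {V : Type*} (G : SimpleGraph V) (ω : ℕ) (hω : 6 ≤ ω)
    (hexc : ∀ S : Finset V,
      ((G.induce (↑S : Set V)).edgeSet.ncard : ℤ) - (S.card : ℤ)
        + (Nat.card ((G.induce (↑S : Set V)).ConnectedComponent) : ℤ) ≤ (ω : ℤ))
    (i j : V) (k : ℕ) (hk : 1 ≤ k) :
    Nat.card {w : Fin (G.dist i j + k) → V //
      w ⟨0, by omega⟩ = i ∧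
      w ⟨G.dist i j + k - 1, by omega⟩ = j ∧
      (∀ m : ℕ, (h : m + 1 < G.dist i j + k) →
        G.Adj (w ⟨m, by omega⟩) (w ⟨m + 1, h⟩)) ∧
      (∀ m : ℕ, (h : m + 2 < G.dist i j + k) →
        w ⟨m, by omega⟩ ≠ w ⟨m + 2, h⟩)} ≤ 2 ^ (ω * k) := by
  classical
  by_cases hij : G.Reachable i j
  · obtain ⟨p, hp⟩ := SimpleGraph.exists_isParentMap G j
    have hfin := hp.finite_chords hexc
    have hL : (hfin.toFinset : Set (V × V)) = G.chords j p := hfin.coe_toFinset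
    have hcard := hp.card_le_of_subset_chords hexc hfin.toFinset hL.le
    have hmain := hp.encard_nbWalks_le hω hL hcard rfl _ hij (k - 1) rfl
    set D := {e ∈ hfin.toFinset | G.dist e.2 j + 1 = G.dist e.1 j}
    have hD : D.card ≤ ω := by
      have := two_mul_card_le_of_swap_notMem (L := hfin.toFinset) (E := D)
        (fun e he => hfin.mem_toFinset.2 (SimpleGraph.swap_mem_chords (hfin.mem_toFinset.1 he)))
        (Finset.filter_subset _ _) (by
          intro e h1 h2
          have h3 := (Finset.mem_filter.1 h1).2
          have h4 := (Finset.mem_filter.1 h2).2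
          simp only [Prod.fst_swap, Prod.snd_swap] at h4
          omega)
      omega
    have hwalks : (G.nbWalks j i (G.dist i j + (k - 1))).encard ≤ (2 ^ (ω * k) : ℕ) := by
      refine hmain.trans (Nat.cast_le.2 ?_)
      rw [← pow_add]
      refine Nat.pow_le_pow_right (by norm_num) ?_
      have h1 : ω * k = ω + ω * (k - 1) := by
        obtain ⟨k, rfl⟩ := Nat.exists_eq_add_of_le' hk
        rw [Nat.add_sub_cancel]
        ring
      have h2 := (Finset.card_filter_le D fun e => G.dist e.1 j ≤ G.dist i j).trans hD
      omega
    have hfinite := Set.finite_of_encard_le_coe hwalks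
    have : Finite (G.nbWalks j i (G.dist i j + (k - 1))) := hfinite
    refine le_trans (Nat.card_le_card_of_injective
      (β := G.nbWalks j i (G.dist i j + (k - 1)))
      (fun w => ⟨fun m => if h : m < G.dist i j + k then w.1 ⟨m, h⟩ else j, ?_⟩) ?_) ?_
    · obtain ⟨w, h1, h2, h3, h4⟩ := w
      refine ⟨?_, fun m hm => ?_, fun m hm => ?_, fun m hm => ?_⟩
      · simpa [show 0 < G.dist i j + k by omega] using h1
      · dsimp only
        split_ifs with h
        · obtain rfl : m = G.dist i j + k - 1 := by omega
          exact h2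
        · rfl
      · dsimp only
        rw [dif_pos (by omega), dif_pos (by omega)]
        exact h3 m (by omega)
      · dsimp only
        rw [dif_pos (by omega), dif_pos (by omega)]
        exact h4 m (by omega)
    · intro w w' h
      ext ⟨m, hm⟩
      have := congrFun (Subtype.ext_iff.1 h) m
      simpa [hm] using this
    · rw [Nat.card_coe_set_eq]
      exact_mod_cast (hfinite.cast_ncard_eq ▸ hwalks)
  · have : IsEmpty {w : Fin (G.dist i j + k) → V //
      w ⟨0, by omega⟩ = i ∧
      w ⟨G.dist i j + k - 1, by omega⟩ = j ∧
      (∀ m : ℕ, (h : m + 1 < G.dist i j + k) →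
        G.Adj (w ⟨m, by omega⟩) (w ⟨m + 1, h⟩)) ∧
      (∀ m : ℕ, (h : m + 2 < G.dist i j + k) →
        w ⟨m, by omega⟩ ≠ w ⟨m + 2, h⟩)} := by
      refine ⟨fun ⟨w, h1, h2, h3, _⟩ => hij ?_⟩
      have key : ∀ m, (h : m < G.dist i j + k) → G.Reachable i (w ⟨m, h⟩) := by
        intro m
        induction m with
        | zero => intro h; rw [h1]
        | succ m ih => exact fun h => (ih (by omega)).trans (h3 m h).reachable
      exact h2 ▸ key _ _
    rw [Nat.card_of_isEmpty]
    exact Nat.zero_le _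
end
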